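/- arXiv:1007.1764 — 2 statements merged into one kernel-verified Lean document; each statement's English description precedes it below -/
import Mathlib

section
/- For all integers 0 ≤ l ≤ n, the Appell polynomial A_n^l is an ℍ-valued polynomial function of (x₀, x₁, x₂), homogeneous of degree n (A_n^l(tx) = tⁿ·A_n^l(x) for all real t), and is monogenic on all of ℝ³: ∂̄A_n^l = 0 on ℝ³. -/
open MeasureTheory Metric Finset

noncomputable section

/-- `ℝ³` with the Euclidean norm and Lebesgue measure. -/
abbrev R3 := EuclideanSpace ℝ (Fin 3)
/-- the real quaternions ℍ -/
abbrev QH := Quaternion ℝ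

/-- the basis quaternion e₁ -/
def e1 : QH := ⟨0,1,0,0⟩
/-- the basis quaternion e₂ -/
def e2 : QH := ⟨0,0,1,0⟩
/-- the basis quaternion e₃ -/
def e3 : QH := ⟨0,0,0,1⟩

/-- embed a point of ℝ³ as the reduced quaternion x₀ + x₁e₁ + x₂e₂ -/
def toQ (x : R3) : QH := ⟨x 0, x 1, x 2, 0⟩
/-- the conjugate reduced quaternion x₀ - x₁e₁ - x₂e₂ -/
def toQbar (x : R3) : QH := ⟨x 0, -(x 1), -(x 2), 0⟩
/-- ζ = x₁ - x₂e₃ -/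
def zeta (x : R3) : QH := ⟨x 1, 0, 0, -(x 2)⟩

/-- build a point of ℝ³ from coordinates -/
def mk3 (a b c : ℝ) : R3 := (WithLp.equiv 2 (Fin 3 → ℝ)).symm ![a, b, c]

/-- the conjugated point (x₀, -x₁, -x₂) -/
def barPt (x : R3) : R3 := mk3 (x 0) (-(x 1)) (-(x 2))

/-- partial derivative ∂f/∂xᵢ -/
def pd (i : Fin 3) (f : R3 → QH) (x : R3) : QH :=
  fderiv ℝ f x (EuclideanSpace.single i 1)

/-- the generalized Cauchy-Riemann operator ∂̄f = ∂f/∂x₀ + e₁∂f/∂x₁ + e₂∂f/∂x₂ -/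
def CRbar (f : R3 → QH) (x : R3) : QH :=
  pd 0 f x + e1 * pd 1 f x + e2 * pd 2 f x

/-- the adjoint generalized Cauchy-Riemann operator ∂f = ∂f/∂x₀ - e₁∂f/∂x₁ - e₂∂f/∂x₂ -/
def Dadj (f : R3 → QH) (x : R3) : QH :=
  pd 0 f x - e1 * pd 1 f x - e2 * pd 2 f x

/-- the hypercomplex derivative ∂₀ = (1/2)∂ -/
def D0 (f : R3 → QH) : R3 → QH := fun x =>
  (1/2 : ℝ) • (pd 0 f x - e1 * pd 1 f x - e2 * pd 2 f x)

/-- the operator ∂̄_ℂ f = (1/2)(∂f/∂x₁ + e₃∂f/∂x₂) -/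
def DbarC (f : R3 → QH) : R3 → QH := fun x =>
  (1/2 : ℝ) • (pd 1 f x + e3 * pd 2 f x)

/-- the involution f⁰ + f¹e₁ + f²e₂ + f³e₃ ↦ f⁰ - f¹e₁ - f²e₂ + f³e₃ -/
def invol (a : QH) : QH := ⟨a.re, -a.imI, -a.imJ, a.imK⟩

/-- the inner Appell polynomial A_n^l -/
def appell (n l : ℕ) (x : R3) : QH :=
  ((n.factorial * l.factorial : ℝ) /
      (2 ^ (2 * (n - l)) * (n + l + 1).factorial * (2 * l).factorial)) •
    ((∑ h ∈ Finset.range (n - l + 1),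
        (((2 * n - 2 * h + 1).factorial * (2 * l + 2 * h).factorial : ℝ) /
            (h.factorial * (n - l - h).factorial * (n - h).factorial * (l + h).factorial)) •
          (toQbar x ^ h * toQ x ^ (n - l - h))) * zeta x ^ l)

/-- the Kelvin transform K(P)(x) = (x̄/|x|³)·P(x̄/|x|²) -/
def kelvin (P : R3 → QH) (x : R3) : QH :=
  ((‖x‖ ^ 3)⁻¹ • toQbar x) * P ((‖x‖ ^ 2)⁻¹ • barPt x)

/-- the outer Appell function A_{-(n+2)}^l -/
def outerAppell (n l : ℕ) (x : R3) : QH :=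
  (((n + l + 1).factorial * (n - l).factorial : ℝ) / (n.factorial * (n + 1).factorial)) •
    kelvin (appell n l) x

/-- surface integral over the sphere of radius ρ (parametrized by the unit sphere
with its surface measure, with the Jacobian factor ρ²) -/
def sphereIntegral (ρ : ℝ) (g : R3 → QH) : QH :=
  ∫ ω : sphere (0 : R3) 1, (ρ ^ 2) • g (ρ • (ω : R3)) ∂((volume : Measure R3).toSphere)

/-- the unified family ψ_k^l, k ∈ ℤ \ {-1}: inner Appell polynomials for k ≥ 0,
outer Appell functions for k ≤ -2 -/
def psiFam (k : ℤ) (l : ℕ) (x : R3) : QH :=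
  if 0 ≤ k then appell k.toNat l x else outerAppell (-k - 2).toNat l x

@[simp]
lemma one_components :
    (1 : QH).re = 1 ∧ (1 : QH).imI = 0 ∧ (1 : QH).imJ = 0 ∧ (1 : QH).imK = 0 :=
  ⟨rfl, rfl, rfl, rfl⟩

@[simp]
lemma e1_components : e1.re = 0 ∧ e1.imI = 1 ∧ e1.imJ = 0 ∧ e1.imK = 0 := ⟨rfl, rfl, rfl, rfl⟩

@[simp]
lemma e2_components : e2.re = 0 ∧ e2.imI = 0 ∧ e2.imJ = 1 ∧ e2.imK = 0 := ⟨rfl, rfl, rfl, rfl⟩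

@[simp]
lemma e3_components : e3.re = 0 ∧ e3.imI = 0 ∧ e3.imJ = 0 ∧ e3.imK = 1 := ⟨rfl, rfl, rfl, rfl⟩

@[simp]
lemma toQ_components (x : R3) :
    (toQ x).re = x 0 ∧ (toQ x).imI = x 1 ∧ (toQ x).imJ = x 2 ∧ (toQ x).imK = 0 :=
  ⟨rfl, rfl, rfl, rfl⟩

@[simp]
lemma toQbar_components (x : R3) :
    (toQbar x).re = x 0 ∧ (toQbar x).imI = -x 1 ∧ (toQbar x).imJ = -x 2 ∧ (toQbar x).imK = 0 :=
  ⟨rfl, rfl, rfl, rfl⟩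

@[simp]
lemma zeta_components (x : R3) :
    (zeta x).re = x 1 ∧ (zeta x).imI = 0 ∧ (zeta x).imJ = 0 ∧ (zeta x).imK = -x 2 :=
  ⟨rfl, rfl, rfl, rfl⟩

lemma toQ_eq (x : R3) : toQ x = x 0 • (1 : QH) + x 1 • e1 + x 2 • e2 := by
  apply Quaternion.ext <;> simp

lemma toQbar_eq (x : R3) : toQbar x = x 0 • (1 : QH) + x 1 • (-e1) + x 2 • (-e2) := by
  apply Quaternion.ext <;> simp

lemma zeta_eq (x : R3) : zeta x = x 0 • (0 : QH) + x 1 • (1 : QH) + x 2 • (-e3) := by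
  apply Quaternion.ext <;> simp

lemma star_toQ (x : R3) : star (toQ x) = toQbar x := by
  apply Quaternion.ext <;> simp

lemma star_toQbar (x : R3) : star (toQbar x) = toQ x := by
  apply Quaternion.ext <;> simp

lemma commute_toQ_toQbar (x : R3) : Commute (toQ x) (toQbar x) := by
  apply Quaternion.ext <;> simp <;> ring

lemma commute_e3_zeta (x : R3) : Commute e3 (zeta x) := by
  apply Quaternion.ext <;> simp

/-! ### Smoothness -/

lemma contDiff_coord_combination (a b c : QH) :
    ContDiff ℝ 1 (fun x : R3 => x 0 • a + x 1 • b + x 2 • c) := by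
  fun_prop

lemma contDiff_toQ : ContDiff ℝ 1 toQ := by
  simpa only [← toQ_eq] using contDiff_coord_combination 1 e1 e2

lemma contDiff_toQbar : ContDiff ℝ 1 toQbar := by
  simpa only [← toQbar_eq] using contDiff_coord_combination 1 (-e1) (-e2)

lemma contDiff_zeta : ContDiff ℝ 1 zeta := by
  simpa only [← zeta_eq] using contDiff_coord_combination 0 1 (-e3)

lemma contDiff_appell (n l : ℕ) : ContDiff ℝ 1 (appell n l) := by
  unfold appell
  have h₁ := contDiff_toQ
  have h₂ := contDiff_toQbar
  have h₃ := contDiff_zeta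
  refine ContDiff.const_smul _ (ContDiff.mul (ContDiff.sum fun h _ => ?_) (h₃.pow l))
  exact ContDiff.const_smul _ ((h₂.pow h).mul (h₁.pow _))

lemma continuous_CRbar {f : R3 → QH} (hf : ContDiff ℝ 1 f) : Continuous (CRbar f) := by
  have h : ∀ i, Continuous (pd i f) := fun i =>
    (hf.continuous_fderiv (by norm_num)).clm_apply continuous_const
  exact ((h 0).add (continuous_const.mul (h 1))).add (continuous_const.mul (h 2))

/-! ### Homogeneity -/

lemma toQ_smul (t : ℝ) (x : R3) : toQ (t • x) = t • toQ x := by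
  apply Quaternion.ext <;> simp

lemma toQbar_smul (t : ℝ) (x : R3) : toQbar (t • x) = t • toQbar x := by
  apply Quaternion.ext <;> simp

lemma zeta_smul (t : ℝ) (x : R3) : zeta (t • x) = t • zeta x := by
  apply Quaternion.ext <;> simp

lemma appell_smul {n l : ℕ} (hl : l ≤ n) (t : ℝ) (x : R3) :
    appell n l (t • x) = t ^ n • appell n l x := by
  unfold appell
  rw [smul_comm (t ^ n)]
  congr 1
  rw [Finset.sum_mul, Finset.sum_mul, Finset.smul_sum]
  refine Finset.sum_congr rfl fun h hh => ?_
  have hn : n = h + (n - l - h) + l := by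
    rw [Finset.mem_range] at hh
    omega
  conv_rhs => rw [hn, pow_add, pow_add]
  rw [toQ_smul, toQbar_smul, zeta_smul, smul_pow, smul_pow, smul_pow]
  simp only [smul_mul_assoc, mul_smul_comm, smul_smul]
  rw [← hn]
  congr 1
  ring

/-! ### Polynomiality -/

/-- `f` is a polynomial function of the coordinates with coefficients in `ℍ`. -/
def IsQPolynomial (f : R3 → QH) : Prop :=
  ∃ c : (ℕ × ℕ × ℕ) →₀ QH, ∀ x : R3,
    f x = c.sum fun m a => (x 0 ^ m.1 * x 1 ^ m.2.1 * x 2 ^ m.2.2) • a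

namespace IsQPolynomial

lemma monomial (i j k : ℕ) (q : QH) :
    IsQPolynomial fun x => (x 0 ^ i * x 1 ^ j * x 2 ^ k) • q :=
  ⟨Finsupp.single (i, j, k) q, fun x => by simp⟩

lemma const (q : QH) : IsQPolynomial fun _ => q := by
  simpa using monomial 0 0 0 q

lemma add {f g : R3 → QH} (hf : IsQPolynomial f) (hg : IsQPolynomial g) :
    IsQPolynomial fun x => f x + g x := by
  obtain ⟨c, hc⟩ := hf
  obtain ⟨d, hd⟩ := hg
  refine ⟨c + d, fun x => ?_⟩
  simp only [hc, hd]
  rw [Finsupp.sum_add_index'] <;> simp [smul_add]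

lemma sum {ι : Type*} (s : Finset ι) {f : ι → R3 → QH} (hf : ∀ i ∈ s, IsQPolynomial (f i)) :
    IsQPolynomial fun x => ∑ i ∈ s, f i x := by
  classical
  induction s using Finset.induction_on with
  | empty => simpa using const 0
  | insert i s hi ih =>
    simp only [Finset.sum_insert hi]
    exact (hf i (Finset.mem_insert_self i s)).add
      (ih fun j hj => hf j (Finset.mem_insert_of_mem hj))

lemma mul {f g : R3 → QH} (hf : IsQPolynomial f) (hg : IsQPolynomial g) :
    IsQPolynomial fun x => f x * g x := by
  obtain ⟨c, hc⟩ := hf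
  obtain ⟨d, hd⟩ := hg
  simp only [hc, hd, Finsupp.sum, Finset.sum_mul, Finset.mul_sum]
  refine sum _ fun q _ => sum _ fun p _ => ?_
  convert monomial (p.1 + q.1) (p.2.1 + q.2.1) (p.2.2 + q.2.2) (c p * d q) using 2 with x
  rw [smul_mul_smul_comm]
  congr 1
  ring

lemma pow {f : R3 → QH} (hf : IsQPolynomial f) (k : ℕ) : IsQPolynomial fun x => f x ^ k := by
  induction k with
  | zero => simpa using const 1
  | succ k ih => simpa only [pow_succ] using ih.mul hf

lemma const_smul {f : R3 → QH} (hf : IsQPolynomial f) (t : ℝ) :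
    IsQPolynomial fun x => t • f x := by
  simpa using (const (t • 1)).mul hf

lemma coord_combination (a b c : QH) :
    IsQPolynomial fun x => x 0 • a + x 1 • b + x 2 • c := by
  simpa using ((monomial 1 0 0 a).add (monomial 0 1 0 b)).add (monomial 0 0 1 c)

end IsQPolynomial

lemma isQPolynomial_appell (n l : ℕ) : IsQPolynomial (appell n l) := by
  have h₁ : IsQPolynomial toQ := by
    simpa only [← toQ_eq] using IsQPolynomial.coord_combination 1 e1 e2
  have h₂ : IsQPolynomial toQbar := by
    simpa only [← toQbar_eq] using IsQPolynomial.coord_combination 1 (-e1) (-e2)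
  have h₃ : IsQPolynomial zeta := by
    simpa only [← zeta_eq] using IsQPolynomial.coord_combination 0 1 (-e3)
  exact ((IsQPolynomial.sum _ fun h _ => ((h₂.pow h).mul (h₁.pow _)).const_smul _).mul
    (h₃.pow l)).const_smul _

/-! ### Partial derivatives -/

lemma pd_mul (i : Fin 3) {f g : R3 → QH} {x : R3} (hf : DifferentiableAt ℝ f x)
    (hg : DifferentiableAt ℝ g x) :
    pd i (fun y => f y * g y) x = pd i f x * g x + f x * pd i g x := by
  simp [pd, fderiv_fun_mul' hf hg, add_comm]

lemma pd_add (i : Fin 3) {f g : R3 → QH} {x : R3} (hf : DifferentiableAt ℝ f x)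
    (hg : DifferentiableAt ℝ g x) :
    pd i (fun y => f y + g y) x = pd i f x + pd i g x := by
  simp [pd, fderiv_fun_add hf hg]

lemma pd_const_smul (i : Fin 3) {f : R3 → QH} {x : R3} (hf : DifferentiableAt ℝ f x) (t : ℝ) :
    pd i (fun y => t • f y) x = t • pd i f x := by
  simp [pd, fderiv_fun_const_smul hf]

lemma pd_const (i : Fin 3) (q : QH) (x : R3) : pd i (fun _ => q) x = 0 := by
  simp [pd]

lemma pd_coord_combination (a b c : QH) (i : Fin 3) (x : R3) :
    pd i (fun y : R3 => y 0 • a + y 1 • b + y 2 • c) x = ![a, b, c] i := by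
  have hp : ∀ (j : Fin 3) (q : QH), HasFDerivAt (fun y : R3 => y j • q)
      ((EuclideanSpace.proj j : R3 →L[ℝ] ℝ).smulRight q) x := fun j q =>
    ((EuclideanSpace.proj j : R3 →L[ℝ] ℝ).smulRight q).hasFDerivAt
  rw [pd, (((hp 0 a).fun_add (hp 1 b)).fun_add (hp 2 c)).fderiv]
  fin_cases i <;> simp

lemma pd_toQ (i : Fin 3) (x : R3) : pd i toQ x = ![1, e1, e2] i := by
  simpa only [← toQ_eq] using pd_coord_combination 1 e1 e2 i x

lemma pd_toQbar (i : Fin 3) (x : R3) : pd i toQbar x = ![1, -e1, -e2] i := by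
  simpa only [← toQbar_eq] using pd_coord_combination 1 (-e1) (-e2) i x

lemma pd_zeta (i : Fin 3) (x : R3) : pd i zeta x = ![0, 1, -e3] i := by
  simpa only [← zeta_eq] using pd_coord_combination 0 1 (-e3) i x

lemma differentiableAt_toQ (x : R3) : DifferentiableAt ℝ toQ x :=
  contDiff_toQ.differentiable (by norm_num) x

lemma differentiableAt_toQbar (x : R3) : DifferentiableAt ℝ toQbar x :=
  contDiff_toQbar.differentiable (by norm_num) x

lemma differentiableAt_zeta (x : R3) : DifferentiableAt ℝ zeta x :=
  contDiff_zeta.differentiable (by norm_num) x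

/-- `ζ` is holomorphic in `(x₁, x₂)` with respect to the imaginary unit `-e₃`; so are its powers,
and the derivative `w` of `ζ ^ l` satisfies `ζ w = l ζ ^ l`. -/
lemma pd_zeta_pow (l : ℕ) (x : R3) :
    pd 0 (fun y => zeta y ^ l) x = 0 ∧ ∃ w : QH, pd 1 (fun y => zeta y ^ l) x = w ∧
      pd 2 (fun y => zeta y ^ l) x = -e3 * w ∧ zeta x * w = (l : ℝ) • zeta x ^ l := by
  induction l with
  | zero => exact ⟨by simp [pd], 0, by simp [pd], by simp [pd], by simp⟩
  | succ l ih =>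
    obtain ⟨h₀, w, h₁, h₂, hw⟩ := ih
    have hz := differentiableAt_zeta x
    simp only [pow_succ, pd_mul _ (hz.fun_pow l) hz, h₀, h₁, h₂, pd_zeta]
    refine ⟨by simp, _, rfl, ?_, ?_⟩
    · have := ((commute_e3_zeta x).pow_right l).eq
      simp only [Matrix.cons_val, Matrix.cons_val_one, mul_add, mul_one, mul_neg, neg_mul, this]
      simp [mul_assoc]
    · have : zeta x * zeta x ^ l = zeta x ^ l * zeta x := (Commute.self_pow _ _).eq
      simp only [Matrix.cons_val, Matrix.cons_val_one, mul_add, mul_one, ← mul_assoc, hw, this]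
      push_cast
      rw [add_smul, one_smul, smul_mul_assoc]

/-! ### Axially symmetric functions -/

/-- The vector part `x₁e₁ + x₂e₂` of a point of `ℝ³`. -/
def vecPart (x : R3) : QH := ⟨0, x 1, x 2, 0⟩

@[simp]
lemma vecPart_components (x : R3) :
    (vecPart x).re = 0 ∧ (vecPart x).imI = x 1 ∧ (vecPart x).imJ = x 2 ∧ (vecPart x).imK = 0 :=
  ⟨rfl, rfl, rfl, rfl⟩

/-- The first-order jet of `f` at `x` is that of an axially symmetric function `U + ωV`, where
`ω = x₁e₁ + x₂e₂` and `U`, `V` are real functions of `x₀` and `|ω|²`, and `E` is the value at `x`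
of the planar Cauchy–Riemann operator `2 ∂/∂z̄`, where `z = x₀ + ω`, applied to `f`. -/
def AxialAt (f : R3 → QH) (x : R3) (E : QH) : Prop :=
  DifferentiableAt ℝ f x ∧ ∃ U V U₀ U₁ V₀ V₁ : ℝ,
    f x = U • (1 : QH) + V • vecPart x ∧
    pd 0 f x = U₀ • (1 : QH) + V₀ • vecPart x ∧
    pd 1 f x = (x 1 * U₁) • (1 : QH) + (x 1 * V₁) • vecPart x + V • e1 ∧
    pd 2 f x = (x 2 * U₁) • (1 : QH) + (x 2 * V₁) • vecPart x + V • e2 ∧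
    E = (U₀ - V - (x 1 ^ 2 + x 2 ^ 2) * V₁) • (1 : QH) + (U₁ + V₀) • vecPart x

namespace AxialAt

variable {f g : R3 → QH} {x : R3} {E F : QH}

lemma const_one (x : R3) : AxialAt (fun _ => 1) x 0 :=
  ⟨differentiableAt_const _, 1, 0, 0, 0, 0, 0, by simp [pd_const]⟩

lemma zero (x : R3) : AxialAt (fun _ => 0) x 0 :=
  ⟨differentiableAt_const _, 0, 0, 0, 0, 0, 0, by simp [pd_const]⟩

lemma toQ (x : R3) : AxialAt toQ x 0 := by
  refine ⟨differentiableAt_toQ x, x 0, 1, 1, 0, 0, 0, ?_⟩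
  simp only [pd_toQ]
  refine ⟨?_, ?_, ?_, ?_, ?_⟩ <;> apply Quaternion.ext <;> simp

lemma toQbar (x : R3) : AxialAt toQbar x ((2 : ℝ) • 1) := by
  refine ⟨differentiableAt_toQbar x, x 0, -1, 1, 0, 0, 0, ?_⟩
  simp only [pd_toQbar]
  refine ⟨?_, ?_, ?_, ?_, ?_⟩ <;> apply Quaternion.ext <;> simp; norm_num

lemma add (hf : AxialAt f x E) (hg : AxialAt g x F) : AxialAt (fun y => f y + g y) x (E + F) := by
  obtain ⟨df, U, V, U₀, U₁, V₀, V₁, h, h₀, h₁, h₂, rfl⟩ := hf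
  obtain ⟨dg, A, B, A₀, A₁, B₀, B₁, k, k₀, k₁, k₂, rfl⟩ := hg
  refine ⟨df.fun_add dg, U + A, V + B, U₀ + A₀, U₁ + A₁, V₀ + B₀, V₁ + B₁, ?_⟩
  simp only [pd_add _ df dg, h, h₀, h₁, h₂, k, k₀, k₁, k₂]
  refine ⟨?_, ?_, ?_, ?_, ?_⟩ <;> module

lemma const_smul (hf : AxialAt f x E) (t : ℝ) : AxialAt (fun y => t • f y) x (t • E) := by
  obtain ⟨df, U, V, U₀, U₁, V₀, V₁, h, h₀, h₁, h₂, rfl⟩ := hf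
  refine ⟨df.fun_const_smul t, t * U, t * V, t * U₀, t * U₁, t * V₀, t * V₁, ?_⟩
  simp only [pd_const_smul _ df, h, h₀, h₁, h₂]
  refine ⟨?_, ?_, ?_, ?_, ?_⟩ <;> module

lemma mul (hf : AxialAt f x E) (hg : AxialAt g x F) :
    AxialAt (fun y => f y * g y) x (E * g x + f x * F) := by
  obtain ⟨df, U, V, U₀, U₁, V₀, V₁, h, h₀, h₁, h₂, rfl⟩ := hf
  obtain ⟨dg, A, B, A₀, A₁, B₀, B₁, k, k₀, k₁, k₂, rfl⟩ := hg
  refine ⟨df.fun_mul dg, U * A - (x 1 ^ 2 + x 2 ^ 2) * (V * B), U * B + V * A,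
    U₀ * A + U * A₀ - (x 1 ^ 2 + x 2 ^ 2) * (V₀ * B + V * B₀),
    U₁ * A + U * A₁ - 2 * (V * B) - (x 1 ^ 2 + x 2 ^ 2) * (V₁ * B + V * B₁),
    U₀ * B + U * B₀ + V₀ * A + V * A₀, U₁ * B + U * B₁ + V₁ * A + V * A₁, ?_⟩
  simp only [pd_mul _ df dg, h, h₀, h₁, h₂, k, k₀, k₁, k₂]
  refine ⟨?_, ?_, ?_, ?_, ?_⟩ <;> apply Quaternion.ext <;> simp <;> ring

lemma sum {ι : Type*} (s : Finset ι) {f : ι → R3 → QH} {E : ι → QH}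
    (hf : ∀ i ∈ s, AxialAt (f i) x (E i)) :
    AxialAt (fun y => ∑ i ∈ s, f i y) x (∑ i ∈ s, E i) := by
  classical
  induction s using Finset.induction_on with
  | empty => simpa using zero x
  | insert i s hi ih =>
    simp only [Finset.sum_insert hi]
    exact (hf i (Finset.mem_insert_self i s)).add
      (ih fun j hj => hf j (Finset.mem_insert_of_mem hj))

lemma toQ_pow (k : ℕ) (x : R3) : AxialAt (fun y => _root_.toQ y ^ k) x 0 := by
  induction k with
  | zero => simpa using const_one x
  | succ k ih => simpa [pow_succ] using ih.mul (toQ x)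

lemma toQbar_pow (k : ℕ) (x : R3) :
    AxialAt (fun y => _root_.toQbar y ^ k) x ((2 * k : ℝ) • _root_.toQbar x ^ (k - 1)) := by
  induction k with
  | zero => simpa using const_one x
  | succ k ih =>
    have h : ((2 * k : ℝ) • _root_.toQbar x ^ (k - 1)) * _root_.toQbar x =
        (2 * k : ℝ) • _root_.toQbar x ^ k := by
      rcases k with _ | k <;> simp [pow_succ]
    have hmul := ih.mul (toQbar x)
    simp only [h, mul_smul_comm, mul_one, ← pow_succ] at hmul
    convert hmul using 1
    rw [Nat.add_sub_cancel]
    push_cast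
    module

/-- The Cauchy–Riemann operator on the product of an axially symmetric function with a power of
`ζ`, multiplied by `2ω = x - x̄`. -/
lemma sub_mul_CRbar_mul_zeta_pow (hf : AxialAt f x E) (l : ℕ) :
    (_root_.toQ x - _root_.toQbar x) * CRbar (fun y => f y * zeta y ^ l) x =
      ((_root_.toQ x - _root_.toQbar x) * E - (2 * l + 1 : ℝ) • (f x - star (f x))) *
        zeta x ^ l := by
  obtain ⟨df, U, V, U₀, U₁, V₀, V₁, h, h₀, h₁, h₂, rfl⟩ := hf
  obtain ⟨z₀, w, z₁, z₂, hw⟩ := pd_zeta_pow l x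
  have key : CRbar (fun y => f y * zeta y ^ l) x =
      ((U₀ - V - (x 1 ^ 2 + x 2 ^ 2) * V₁) • (1 : QH) + (U₁ + V₀) • vecPart x - V • 1) *
        zeta x ^ l - (2 * V) • (zeta x * w) := by
    simp only [CRbar, pd_mul _ df ((differentiableAt_zeta x).fun_pow l), z₀, z₁, z₂, h, h₀, h₁, h₂]
    generalize zeta x ^ l = p
    apply Quaternion.ext <;> simp <;> ring
  rw [key, hw, h]
  generalize zeta x ^ l = p
  apply Quaternion.ext <;> simp <;> ring

end AxialAt

/-! ### The coefficients -/

lemma sub_mul_sum_eq {A : Type*} [Ring A] [Algebra ℝ A] {a b : A} (hab : Commute a b) (m : ℕ)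
    (r : ℝ) (c : ℕ → ℝ)
    (hc : ∀ h < m, 2 * (h + 1) * c (h + 1) - 2 * h * c h = r * (c h - c (m - h)))
    (hm : 2 * m * c m = r * (c 0 - c m)) :
    (a - b) * ∑ h ∈ Finset.range (m + 1), c h • (((2 * h : ℝ) • b ^ (h - 1)) * a ^ (m - h)) =
      r • (∑ h ∈ Finset.range (m + 1), c h • (b ^ h * a ^ (m - h)) -
        ∑ h ∈ Finset.range (m + 1), c h • (b ^ (m - h) * a ^ h)) := by
  have hrefl : ∑ h ∈ Finset.range (m + 1), c h • (b ^ (m - h) * a ^ h) =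
      ∑ h ∈ Finset.range (m + 1), c (m - h) • (b ^ h * a ^ (m - h)) := by
    rw [← Finset.sum_range_reflect]
    refine Finset.sum_congr rfl fun h hh => ?_
    have : h ≤ m := Finset.mem_range_succ_iff.mp hh
    rw [Nat.add_sub_cancel, Nat.sub_sub_self this]
  have hb : b * ∑ h ∈ Finset.range (m + 1), c h • (((2 * h : ℝ) • b ^ (h - 1)) * a ^ (m - h)) =
      ∑ h ∈ Finset.range (m + 1), (2 * h * c h) • (b ^ h * a ^ (m - h)) := by
    rw [Finset.mul_sum]
    refine Finset.sum_congr rfl fun h _ => ?_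
    rcases h with _ | h
    · simp
    · rw [Nat.add_sub_cancel, smul_mul_assoc, smul_smul, mul_smul_comm, ← mul_assoc b,
        ← pow_succ', mul_comm (c _)]
  have ha : a * ∑ h ∈ Finset.range (m + 1), c h • (((2 * h : ℝ) • b ^ (h - 1)) * a ^ (m - h)) =
      ∑ h ∈ Finset.range m, (2 * (h + 1) * c (h + 1)) • (b ^ h * a ^ (m - h)) := by
    rw [Finset.mul_sum, Finset.sum_range_succ']
    simp only [Nat.cast_zero, mul_zero, zero_smul, zero_mul, smul_zero, add_zero]
    refine Finset.sum_congr rfl fun h hh => ?_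
    have : m - h = m - (h + 1) + 1 := by
      have := Finset.mem_range.mp hh
      omega
    rw [Nat.add_sub_cancel, smul_mul_assoc, smul_smul, mul_smul_comm, this, pow_succ',
      ← mul_assoc a, (hab.pow_right h).eq, mul_assoc (b ^ h), mul_comm (c _)]
    push_cast
    rfl
  rw [sub_mul, ha, hb, hrefl, ← Finset.sum_sub_distrib, Finset.smul_sum, Finset.sum_range_succ,
    Finset.sum_range_succ _ m, ← sub_sub, ← Finset.sum_sub_distrib]
  have hlast : r • (c m • (b ^ m * a ^ (m - m)) - c (m - m) • (b ^ m * a ^ (m - m))) =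
      -((2 * m * c m) • (b ^ m * a ^ (m - m))) := by
    rw [hm, Nat.sub_self]
    module
  rw [hlast, sub_eq_add_neg]
  congr 1
  refine Finset.sum_congr rfl fun h hh => ?_
  rw [← sub_smul, hc h (Finset.mem_range.mp hh), ← sub_smul, smul_smul]

/-- The coefficient of `x̄ ^ h * x ^ (n - l - h)` in the sum defining `appell n l`. -/
def appellCoeff (n l h : ℕ) : ℝ :=
  ((2 * n - 2 * h + 1).factorial * (2 * l + 2 * h).factorial : ℝ) /
    (h.factorial * (n - l - h).factorial * (n - h).factorial * (l + h).factorial)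

/-- The quantity `(2l + 2k)! / (k! (l + k)!)`. -/
def halfCoeff (l k : ℕ) : ℝ :=
  (2 * (l + k)).factorial / (k.factorial * (l + k).factorial : ℝ)

lemma succ_mul_halfCoeff (l k : ℕ) :
    ((k : ℝ) + 1) * halfCoeff l (k + 1) = 2 * (2 * (l + k) + 1) * halfCoeff l k := by
  unfold halfCoeff
  rw [show 2 * (l + (k + 1)) = 2 * (l + k) + 1 + 1 by ring, ← add_assoc l k 1]
  simp only [Nat.factorial_succ]
  push_cast
  field_simp
  ring

lemma appellCoeff_eq (l a b : ℕ) :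
    appellCoeff (l + (a + b)) l a = (2 * (l + b) + 1) * halfCoeff l a * halfCoeff l b := by
  unfold appellCoeff halfCoeff
  rw [show 2 * (l + (a + b)) - 2 * a + 1 = 2 * (l + b) + 1 by omega,
    show l + (a + b) - l - a = b by omega, show l + (a + b) - a = l + b by omega,
    ← mul_add 2 l a, Nat.factorial_succ (2 * (l + b))]
  push_cast
  field_simp

lemma appellCoeff_eq' (l a b : ℕ) :
    appellCoeff (l + (a + b)) l b = (2 * (l + a) + 1) * halfCoeff l a * halfCoeff l b := by
  rw [add_comm a b, appellCoeff_eq]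
  ring

lemma appellCoeff_rec (l m h : ℕ) (hh : h < m) :
    2 * (h + 1) * appellCoeff (l + m) l (h + 1) - 2 * h * appellCoeff (l + m) l h =
      (2 * l + 1) * (appellCoeff (l + m) l h - appellCoeff (l + m) l (m - h)) := by
  obtain ⟨b, rfl⟩ : ∃ b, m = h + (b + 1) := ⟨m - h - 1, by omega⟩
  rw [show h + (b + 1) - h = b + 1 by omega, appellCoeff_eq' l h (b + 1),
    appellCoeff_eq l h (b + 1), show h + (b + 1) = h + 1 + b by ring, appellCoeff_eq]
  have h₁ := succ_mul_halfCoeff l h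
  have h₂ := succ_mul_halfCoeff l b
  push_cast
  linear_combination (2 * (2 * (l + b) + 1) * halfCoeff l b) * h₁ -
    (2 * (2 * (l + h) + 1) * halfCoeff l h) * h₂

lemma appellCoeff_last (l m : ℕ) :
    2 * m * appellCoeff (l + m) l m =
      (2 * l + 1) * (appellCoeff (l + m) l 0 - appellCoeff (l + m) l m) := by
  have h₁ := appellCoeff_eq l 0 m
  have h₂ := appellCoeff_eq' l 0 m
  rw [zero_add] at h₁ h₂
  rw [h₁, h₂]
  push_cast
  ring

/-! ### Monogenicity -/

lemma sub_mul_CRbar_appell {n l : ℕ} (hl : l ≤ n) (x : R3) :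
    (toQ x - toQbar x) * CRbar (appell n l) x = 0 := by
  obtain ⟨m, rfl⟩ := Nat.exists_eq_add_of_le hl
  set C : ℝ := ((l + m).factorial * l.factorial : ℝ) /
    (2 ^ (2 * (l + m - l)) * (l + m + l + 1).factorial * (2 * l).factorial)
  have happ : appell (l + m) l = fun y => (C • ∑ h ∈ Finset.range (m + 1),
      appellCoeff (l + m) l h • (toQbar y ^ h * toQ y ^ (m - h))) * zeta y ^ l := by
    funext y
    simp only [appell, appellCoeff, smul_mul_assoc, C, Nat.add_sub_cancel_left]
  have hax := (AxialAt.sum (Finset.range (m + 1)) fun h _ =>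
    ((AxialAt.toQbar_pow h x).mul (AxialAt.toQ_pow (m - h) x)).const_smul
      (appellCoeff (l + m) l h)).const_smul C
  rw [happ, hax.sub_mul_CRbar_mul_zeta_pow l]
  have hsum := sub_mul_sum_eq (commute_toQ_toQbar x) m (2 * l + 1) (appellCoeff (l + m) l)
    (appellCoeff_rec l m) (appellCoeff_last l m)
  have hstar : star (∑ h ∈ Finset.range (m + 1),
      appellCoeff (l + m) l h • (toQbar x ^ h * toQ x ^ (m - h))) =
      ∑ h ∈ Finset.range (m + 1), appellCoeff (l + m) l h • (toQbar x ^ (m - h) * toQ x ^ h) := by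
    simp only [star_sum, Quaternion.star_smul, star_mul, star_pow, star_toQ, star_toQbar]
  simp only [mul_zero, add_zero]
  rw [Quaternion.star_smul, hstar, mul_smul_comm, hsum, ← smul_sub, smul_comm C, sub_self, zero_mul]

lemma CRbar_appell {n l : ℕ} (hl : l ≤ n) (x : R3) : CRbar (appell n l) x = 0 := by
  have hoff : ∀ y : R3, y 1 ≠ 0 → CRbar (appell n l) y = 0 := fun y hy => by
    refine (mul_eq_zero.mp (sub_mul_CRbar_appell hl y)).resolve_left fun h => hy ?_
    have himI : y 1 = -y 1 := congrArg (fun q : QH => q.imI) (sub_eq_zero.mp h)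
    linarith
  have hcont : Continuous fun t : ℝ =>
      CRbar (appell n l) (x + t • EuclideanSpace.single (1 : Fin 3) (1 : ℝ)) :=
    (continuous_CRbar (contDiff_appell n l)).comp (by fun_prop)
  have hzero := hcont.ext_on (dense_compl_singleton (-(x 1))) continuous_const
    (g := fun _ => (0 : QH)) fun t ht => hoff _ fun h => ht (by simp at h ⊢; linarith)
  simpa using congrFun hzero 0

/-- A_n^l is a polynomial function, homogeneous of degree n,
and monogenic on all of ℝ³. -/
theorem appell_polynomial_homogeneous_monogenic (n l : ℕ) (hl : l ≤ n) :
    (∃ (s : Finset (ℕ × ℕ × ℕ)) (c : ℕ × ℕ × ℕ → QH), ∀ x : R3,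
        appell n l x = ∑ m ∈ s, (x 0 ^ m.1 * x 1 ^ m.2.1 * x 2 ^ m.2.2) • c m) ∧
    (∀ (t : ℝ) (x : R3), appell n l (t • x) = t ^ n • appell n l x) ∧
    Differentiable ℝ (appell n l) ∧
    (∀ x : R3, CRbar (appell n l) x = 0) := by
  obtain ⟨c, hc⟩ := isQPolynomial_appell n l
  exact ⟨⟨c.support, c, hc⟩, appell_smul hl,
    (contDiff_appell n l).differentiable (by norm_num), CRbar_appell hl⟩
end
end

section
/- For all integers 0 ≤ l ≤ n, the squared L²-norm of the Appell polynomial over the unit ball is ∫_{B⁺} |A_n^l(x)|² dx = 4^{l+1}·(n!)²·π / ((2n+3)·(n−l)!·(n+l+1)!). -/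
open MeasureTheory Metric Finset

noncomputable section

open scoped ComplexConjugate

/-- The coefficient of `t ^ k` in the binomial series of `(1 - t) ^ (-a)`. -/
def binomCoeff (a : ℝ) (k : ℕ) : ℝ := ∏ i ∈ range k, (a + i) / (i + 1)

@[simp] lemma binomCoeff_zero (a : ℝ) : binomCoeff a 0 = 1 := by simp [binomCoeff]

lemma succ_mul_binomCoeff_succ (a : ℝ) (k : ℕ) :
    (k + 1) * binomCoeff a (k + 1) = (a + k) * binomCoeff a k := by
  have : (k + 1 : ℝ) ≠ 0 := by positivity
  rw [binomCoeff, prod_range_succ, ← binomCoeff]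
  field_simp

lemma mul_binomCoeff_add_one (a : ℝ) (k : ℕ) :
    a * binomCoeff (a + 1) k = (a + k) * binomCoeff a k := by
  induction k with
  | zero => simp
  | succ k ih =>
    have hk : (k + 1 : ℝ) ≠ 0 := by positivity
    apply mul_left_cancel₀ hk
    have h1 := succ_mul_binomCoeff_succ (a + 1) k
    have h2 := succ_mul_binomCoeff_succ a k
    push_cast
    linear_combination a * h1 + (a + 1 + k) * ih - (a + (k + 1)) * h2

lemma binomCoeff_add_one_succ (a : ℝ) (k : ℕ) :
    binomCoeff (a + 1) (k + 1) = binomCoeff (a + 1) k + binomCoeff a (k + 1) := by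
  have hk : (k + 1 : ℝ) ≠ 0 := by positivity
  apply mul_left_cancel₀ hk
  linear_combination succ_mul_binomCoeff_succ (a + 1) k - succ_mul_binomCoeff_succ a k
    + mul_binomCoeff_add_one a k

/-- The coefficient of `t ^ m` in `(1 - t w) ^ (-a) * (1 - t z) ^ (-b)`. -/
def mixedSum (a b : ℝ) (m : ℕ) (w z : ℂ) : ℂ :=
  ∑ p ∈ antidiagonal m, ((binomCoeff a p.1 * binomCoeff b p.2 : ℝ) : ℂ) * (w ^ p.1 * z ^ p.2)

lemma mixedSum_comm (a b : ℝ) (m : ℕ) (w z : ℂ) : mixedSum a b m w z = mixedSum b a m z w := by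
  rw [mixedSum, ← Finset.Nat.sum_antidiagonal_swap, mixedSum]
  refine sum_congr rfl fun p _ => ?_
  simp only [Prod.fst_swap, Prod.snd_swap]
  push_cast; ring

lemma conj_mixedSum (a b : ℝ) (m : ℕ) (w z : ℂ) :
    conj (mixedSum a b m w z) = mixedSum a b m (conj w) (conj z) := by
  simp [mixedSum]

lemma mixedSum_succ_eq_sub (a : ℝ) (m : ℕ) (w z : ℂ) :
    mixedSum a (a + 1) (m + 1) w z =
      mixedSum (a + 1) (a + 1) (m + 1) w z - w * mixedSum (a + 1) (a + 1) m w z := by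
  simp only [mixedSum, Finset.Nat.sum_antidiagonal_succ, binomCoeff_add_one_succ a, mul_sum]
  rw [add_sub_assoc, ← sum_sub_distrib]
  congr 1
  refine sum_congr rfl fun p _ => ?_
  push_cast; ring

lemma sum_fst_mul_mixed (a b : ℝ) (m : ℕ) (w z : ℂ) :
    ∑ p ∈ antidiagonal (m + 1), ((p.1 * (binomCoeff a p.1 * binomCoeff b p.2) : ℝ) : ℂ) *
      (w ^ p.1 * z ^ p.2) = a * w * mixedSum (a + 1) b m w z := by
  simp only [mixedSum, Finset.Nat.sum_antidiagonal_succ, mul_sum]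
  simp only [CharP.cast_eq_zero, zero_mul, Complex.ofReal_zero, zero_add]
  refine sum_congr rfl fun p _ => ?_
  have h : ((p.1 + 1 : ℕ) : ℝ) * binomCoeff a (p.1 + 1) = a * binomCoeff (a + 1) p.1 := by
    push_cast
    rw [succ_mul_binomCoeff_succ, mul_binomCoeff_add_one]
  rw [← mul_assoc ((p.1 + 1 : ℕ) : ℝ), h]
  push_cast; ring

lemma mixedSum_add_swap (a : ℝ) (m : ℕ) (w z : ℂ) :
    a * (mixedSum a (a + 1) m w z + mixedSum a (a + 1) m z w) =
      (2 * a + m) * mixedSum a a m w z := by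
  rw [mixedSum_comm a (a + 1) m z w]
  simp only [mixedSum, ← sum_add_distrib, mul_sum]
  refine sum_congr rfl fun p hp => ?_
  have h1 := congrArg (Complex.ofReal) (mul_binomCoeff_add_one a p.1)
  have h2 := congrArg (Complex.ofReal) (mul_binomCoeff_add_one a p.2)
  have h3 : (m : ℂ) = p.1 + p.2 := by rw [← mem_antidiagonal.1 hp]; push_cast; rfl
  push_cast at h1 h2 ⊢
  rw [h3]
  linear_combination (binomCoeff a p.1 * w ^ p.1 * z ^ p.2) * h2
    + (binomCoeff a p.2 * w ^ p.1 * z ^ p.2) * h1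

/-- The coefficient of `t ^ m` in `(1 - t exp (-iθ)) ^ (-a) * (1 - t exp (iθ)) ^ (-b)`. -/
def circSum (a b : ℝ) (m : ℕ) (θ : ℝ) : ℂ :=
  mixedSum a b m (Complex.exp (-(θ * Complex.I))) (Complex.exp (θ * Complex.I))

/-- The Gegenbauer polynomial `C_m^a` at `cos θ`. -/
def gegenbauerCos (a : ℝ) (m : ℕ) (θ : ℝ) : ℝ := (circSum a a m θ).re

lemma conj_exp_mul_I (θ : ℝ) :
    conj (Complex.exp (θ * Complex.I)) = Complex.exp (-(θ * Complex.I)) := by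
  rw [← Complex.exp_conj]; simp

lemma conj_exp_neg_mul_I (θ : ℝ) :
    conj (Complex.exp (-(θ * Complex.I))) = Complex.exp (θ * Complex.I) := by
  rw [← Complex.exp_conj]; simp

lemma exp_neg_mul_I_re (θ : ℝ) : (Complex.exp (-(θ * Complex.I))).re = Real.cos θ := by
  rw [← conj_exp_mul_I, Complex.conj_re, Complex.exp_ofReal_mul_I_re]

lemma exp_neg_mul_I_im (θ : ℝ) : (Complex.exp (-(θ * Complex.I))).im = -Real.sin θ := by
  rw [← conj_exp_mul_I, Complex.conj_im, Complex.exp_ofReal_mul_I_im]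

lemma ofReal_gegenbauerCos (a : ℝ) (m : ℕ) (θ : ℝ) :
    (gegenbauerCos a m θ : ℂ) = circSum a a m θ := by
  apply Complex.conj_eq_iff_re.1
  rw [circSum, conj_mixedSum, conj_exp_mul_I, conj_exp_neg_mul_I, mixedSum_comm]

lemma circSum_re (a : ℝ) (m : ℕ) (θ : ℝ) :
    2 * a * (circSum a (a + 1) m θ).re = (2 * a + m) * gegenbauerCos a m θ := by
  have h := mixedSum_add_swap a m (Complex.exp (-(θ * Complex.I))) (Complex.exp (θ * Complex.I))
  have h1 : mixedSum a (a + 1) m (Complex.exp (θ * Complex.I)) (Complex.exp (-(θ * Complex.I)))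
      = conj (circSum a (a + 1) m θ) := by
    rw [circSum, conj_mixedSum, conj_exp_mul_I, conj_exp_neg_mul_I]
  rw [h1, ← circSum, ← circSum, Complex.add_conj, ← ofReal_gegenbauerCos] at h
  have h2 : a * (2 * (circSum a (a + 1) m θ).re) = (2 * a + m) * gegenbauerCos a m θ := by
    exact_mod_cast h
  linarith

lemma circSum_succ_im (a : ℝ) (m : ℕ) (θ : ℝ) :
    (circSum a (a + 1) (m + 1) θ).im = Real.sin θ * gegenbauerCos (a + 1) m θ := by
  rw [circSum, mixedSum_succ_eq_sub, ← circSum, ← circSum, ← ofReal_gegenbauerCos,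
    ← ofReal_gegenbauerCos]
  simp [exp_neg_mul_I_im]

lemma hasDerivAt_circSum (a b : ℝ) (m : ℕ) (θ : ℝ) :
    HasDerivAt (circSum a b (m + 1))
      (Complex.I * (m + 1) * circSum a b (m + 1) θ - 2 * Complex.I * a *
        Complex.exp (-(θ * Complex.I)) * circSum (a + 1) b m θ) θ := by
  have hz : HasDerivAt (fun θ : ℝ => Complex.exp (θ * Complex.I))
      (Complex.exp (θ * Complex.I) * Complex.I) θ := by
    have := ((hasDerivAt_id θ).ofReal_comp.mul_const Complex.I).cexp
    simpa using this
  have hw : HasDerivAt (fun θ : ℝ => Complex.exp (-(θ * Complex.I)))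
      (-(Complex.exp (-(θ * Complex.I)) * Complex.I)) θ := by
    have := ((hasDerivAt_id θ).ofReal_comp.mul_const Complex.I).neg.cexp
    simpa using this
  have key := HasDerivAt.fun_sum (u := antidiagonal (m + 1)) fun p _ =>
    ((hw.pow p.1).mul (hz.pow p.2)).const_mul ((binomCoeff a p.1 * binomCoeff b p.2 : ℝ) : ℂ)
  refine key.congr_deriv ?_
  rw [show 2 * Complex.I * a * Complex.exp (-(θ * Complex.I)) * circSum (a + 1) b m θ =
    2 * Complex.I * (a * Complex.exp (-(θ * Complex.I)) * circSum (a + 1) b m θ) by ring]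
  rw [circSum, circSum, ← sum_fst_mul_mixed, mixedSum, mul_sum, mul_sum, ← sum_sub_distrib]
  refine sum_congr rfl fun p hp => ?_
  have h3 : (m + 1 : ℂ) = p.1 + p.2 := by exact_mod_cast (mem_antidiagonal.1 hp).symm
  have pw : ∀ (k : ℕ) (x : ℂ), (k : ℂ) * x ^ (k - 1) * x = k * x ^ k := by
    intro k x
    cases k with
    | zero => simp
    | succ k => simp [pow_succ, mul_assoc]
  rw [h3]
  have hpw := pw p.1 (Complex.exp (-(θ * Complex.I)))
  have hpz := pw p.2 (Complex.exp (θ * Complex.I))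
  simp only [Pi.pow_apply]
  push_cast
  linear_combination (binomCoeff a p.1 * binomCoeff b p.2 * Complex.I) *
    (Complex.exp (-(θ * Complex.I)) ^ p.1 * hpz - Complex.exp (θ * Complex.I) ^ p.2 * hpw)

lemma hasDerivAt_circSum_re (a : ℝ) (m : ℕ) (θ : ℝ) :
    HasDerivAt (fun θ => (circSum a (a + 1) (m + 1) θ).re)
      (-(2 * a + (m + 1)) * (circSum a (a + 1) (m + 1) θ).im) θ := by
  have h := Complex.reCLM.hasFDerivAt.comp_hasDerivAt θ (hasDerivAt_circSum a (a + 1) m θ)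
  refine h.congr_deriv ?_
  rw [← ofReal_gegenbauerCos]
  have := circSum_succ_im a m θ
  simp [exp_neg_mul_I_re, exp_neg_mul_I_im]
  linear_combination (2 * a) * this

lemma hasDerivAt_circSum_im (a : ℝ) (m : ℕ) (θ : ℝ) :
    HasDerivAt (fun θ => (circSum a (a + 1) (m + 1) θ).im)
      ((m + 1) * (circSum a (a + 1) (m + 1) θ).re
        - 2 * a * Real.cos θ * gegenbauerCos (a + 1) m θ) θ := by
  have h := Complex.imCLM.hasFDerivAt.comp_hasDerivAt θ (hasDerivAt_circSum a (a + 1) m θ)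
  refine h.congr_deriv ?_
  rw [← ofReal_gegenbauerCos]
  simp [exp_neg_mul_I_re, exp_neg_mul_I_im]

@[fun_prop]
lemma continuous_circSum (a b : ℝ) (m : ℕ) : Continuous (circSum a b m) := by
  unfold circSum mixedSum
  fun_prop

@[fun_prop]
lemma continuous_gegenbauerCos (a : ℝ) (m : ℕ) : Continuous (gegenbauerCos a m) :=
  Complex.continuous_re.comp (continuous_circSum a a m)

lemma mul_integral_re_sq (l m : ℕ) :
    (m + 1) * ∫ θ in (0 : ℝ)..Real.pi,
        (circSum (l + 1 / 2) (l + 1 / 2 + 1) (m + 1) θ).re ^ 2 * Real.sin θ ^ (2 * l + 1) =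
      (2 * l + m + 2) * ∫ θ in (0 : ℝ)..Real.pi,
        (circSum (l + 1 / 2) (l + 1 / 2 + 1) (m + 1) θ).im ^ 2 * Real.sin θ ^ (2 * l + 1) := by
  set F := circSum (l + 1 / 2) (l + 1 / 2 + 1) (m + 1) with hF
  have hcont : Continuous F := continuous_circSum _ _ _
  have hderiv : ∀ θ ∈ Set.uIcc 0 Real.pi,
      HasDerivAt (fun θ => (F θ).re * ((F θ).im * Real.sin θ ^ (2 * l + 1)))
        ((m + 1) * ((F θ).re ^ 2 * Real.sin θ ^ (2 * l + 1)) -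
          (2 * l + m + 2) * ((F θ).im ^ 2 * Real.sin θ ^ (2 * l + 1))) θ := by
    intro θ _
    refine ((hasDerivAt_circSum_re _ m θ).mul ((hasDerivAt_circSum_im _ m θ).mul
      ((Real.hasDerivAt_sin θ).pow (2 * l + 1)))).congr_deriv ?_
    have h := circSum_succ_im (l + 1 / 2) m θ
    rw [← hF] at h ⊢
    simp only [Pi.mul_apply, Pi.pow_apply, add_tsub_cancel_right, pow_succ (Real.sin θ) (2 * l)]
    push_cast
    linear_combination (F θ).re * Real.sin θ ^ (2 * l) * Real.cos θ * (2 * l + 1) * h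
  have h := intervalIntegral.integral_eq_sub_of_hasDerivAt hderiv
    (Continuous.intervalIntegrable (by fun_prop) _ _)
  rw [intervalIntegral.integral_sub (Continuous.intervalIntegrable (by fun_prop) _ _)
    (Continuous.intervalIntegrable (by fun_prop) _ _), intervalIntegral.integral_const_mul,
    intervalIntegral.integral_const_mul] at h
  simpa [sub_eq_zero] using h

lemma integral_re_sq (l m : ℕ) :
    ∫ θ in (0 : ℝ)..Real.pi,
        (circSum (l + 1 / 2) (l + 1 / 2 + 1) m θ).re ^ 2 * Real.sin θ ^ (2 * l + 1) =
      ((2 * l + 1 + m) / (2 * l + 1)) ^ 2 * ∫ θ in (0 : ℝ)..Real.pi,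
        gegenbauerCos (l + 1 / 2) m θ ^ 2 * Real.sin θ ^ (2 * l + 1) := by
  rw [← intervalIntegral.integral_const_mul]
  refine intervalIntegral.integral_congr fun θ _ => ?_
  have h := circSum_re (l + 1 / 2) m θ
  have h' : (circSum (l + 1 / 2) (l + 1 / 2 + 1) m θ).re =
      (2 * l + 1 + m) / (2 * l + 1) * gegenbauerCos (l + 1 / 2) m θ := by
    have : (2 * l + 1 : ℝ) ≠ 0 := by positivity
    rw [div_mul_eq_mul_div, eq_div_iff this]
    linear_combination h
  simp only [h']
  ring

lemma integral_im_sq (l m : ℕ) :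
    ∫ θ in (0 : ℝ)..Real.pi,
        (circSum (l + 1 / 2) (l + 1 / 2 + 1) (m + 1) θ).im ^ 2 * Real.sin θ ^ (2 * l + 1) =
      ∫ θ in (0 : ℝ)..Real.pi,
        gegenbauerCos ((l + 1 : ℕ) + 1 / 2) m θ ^ 2 * Real.sin θ ^ (2 * (l + 1) + 1) := by
  refine intervalIntegral.integral_congr fun θ _ => ?_
  simp only [circSum_succ_im]
  rw [show (((l + 1 : ℕ) : ℝ) + 1 / 2) = l + 1 / 2 + 1 by push_cast; ring]
  ring

lemma integral_sin_pow_odd_eq (l : ℕ) :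
    ∫ θ in (0 : ℝ)..Real.pi, Real.sin θ ^ (2 * l + 1) =
      2 * 4 ^ l * (l.factorial : ℝ) ^ 2 / (2 * l + 1).factorial := by
  rw [integral_sin_pow_odd]
  induction l with
  | zero => simp
  | succ l ih =>
    rw [prod_range_succ, ← mul_assoc, ih, show 2 * (l + 1) + 1 = (2 * l + 1) + 1 + 1 by ring]
    simp only [Nat.factorial_succ]
    push_cast
    field_simp
    ring

lemma integral_gegenbauerCos_sq (m l : ℕ) :
    ∫ θ in (0 : ℝ)..Real.pi, gegenbauerCos (l + 1 / 2) m θ ^ 2 * Real.sin θ ^ (2 * l + 1) =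
      2 * 4 ^ l * (m + 2 * l).factorial * (l.factorial : ℝ) ^ 2 /
        (m.factorial * (2 * m + 2 * l + 1) * ((2 * l).factorial : ℝ) ^ 2) := by
  induction m generalizing l with
  | zero =>
    simp only [gegenbauerCos, circSum, mixedSum]
    simp [integral_sin_pow_odd_eq, Nat.factorial_succ]
    field_simp
  | succ m ih =>
    have h := mul_integral_re_sq l m
    rw [integral_re_sq, integral_im_sq, ih] at h
    rw [show m + 2 * (l + 1) = m + 2 * l + 1 + 1 by ring,
      show 2 * (l + 1) = 2 * l + 1 + 1 by ring] at h
    rw [show m + 1 + 2 * l = m + 2 * l + 1 by ring]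
    simp only [Nat.factorial_succ] at h ⊢
    push_cast at h ⊢
    set J := ∫ θ in (0 : ℝ)..Real.pi,
      gegenbauerCos (l + 1 / 2) (m + 1) θ ^ 2 * Real.sin θ ^ (2 * l + 1)
    have h1 : (m + 1 : ℝ) * ((2 * l + 1 + (m + 1)) / (2 * l + 1)) ^ 2 ≠ 0 := by positivity
    rw [← mul_assoc] at h
    apply mul_left_cancel₀ h1
    rw [h]
    field_simp
    ring

lemma integral_norm_circSum_sq (m l : ℕ) :
    ∫ θ in (0 : ℝ)..Real.pi,
        ‖circSum (l + 1 / 2) (l + 1 / 2 + 1) m θ‖ ^ 2 * Real.sin θ ^ (2 * l + 1) =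
      2 * 4 ^ l * (m + 2 * l + 1).factorial * (l.factorial : ℝ) ^ 2 /
        (m.factorial * ((2 * l + 1).factorial : ℝ) ^ 2) := by
  have hF : Continuous (circSum (l + 1 / 2) (l + 1 / 2 + 1) m) := continuous_circSum _ _ _
  simp only [Complex.sq_norm, Complex.normSq_apply, ← pow_two, add_mul]
  rw [intervalIntegral.integral_add (Continuous.intervalIntegrable (by fun_prop) _ _)
    (Continuous.intervalIntegrable (by fun_prop) _ _)]
  have hre := integral_re_sq l m
  rw [integral_gegenbauerCos_sq] at hre
  cases m with
  | zero =>
    rw [hre]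
    simp [circSum, mixedSum, Nat.factorial_succ]
    field_simp
  | succ m =>
    have h := mul_integral_re_sq l m
    have him : ∫ θ in (0 : ℝ)..Real.pi,
        (circSum (l + 1 / 2) (l + 1 / 2 + 1) (m + 1) θ).im ^ 2 * Real.sin θ ^ (2 * l + 1) =
        (m + 1) / (2 * l + m + 2) * ∫ θ in (0 : ℝ)..Real.pi,
        (circSum (l + 1 / 2) (l + 1 / 2 + 1) (m + 1) θ).re ^ 2 * Real.sin θ ^ (2 * l + 1) := by
      rw [div_mul_eq_mul_div, h]
      field_simp
    rw [him, hre]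
    simp only [Nat.factorial_succ]
    push_cast
    field_simp
    ring

/-- The reduced quaternion imaginary unit `cos φ e₁ + sin φ e₂`. -/
def unitImag (φ : ℝ) : QH := ⟨0, Real.cos φ, Real.sin φ, 0⟩

@[simp] lemma unitImag_re (φ : ℝ) : (unitImag φ).re = 0 := rfl
@[simp] lemma unitImag_imI (φ : ℝ) : (unitImag φ).imI = Real.cos φ := rfl
@[simp] lemma unitImag_imJ (φ : ℝ) : (unitImag φ).imJ = Real.sin φ := rfl
@[simp] lemma unitImag_imK (φ : ℝ) : (unitImag φ).imK = 0 := rfl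

lemma unitImag_mul_self (φ : ℝ) : unitImag φ * unitImag φ = -1 := by
  apply Quaternion.ext
  · simp only [Quaternion.re_mul, Quaternion.re_neg, Quaternion.re_one, unitImag_re,
      unitImag_imI, unitImag_imJ, unitImag_imK]
    linear_combination -Real.sin_sq_add_cos_sq φ
  · simp [Quaternion.imI_one]
  · simp [Quaternion.imJ_one]
  · simp [Quaternion.imK_one, mul_comm]

/-- The embedding of `ℂ` into the quaternions that sends `I` to `cos φ e₁ + sin φ e₂`. -/
def complexEmb (φ : ℝ) : ℂ →ₐ[ℝ] QH := Complex.liftAux (unitImag φ) (unitImag_mul_self φ)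

lemma complexEmb_apply (φ : ℝ) (z : ℂ) :
    complexEmb φ z = ⟨z.re, z.im * Real.cos φ, z.im * Real.sin φ, 0⟩ := by
  rw [complexEmb, Complex.liftAux_apply]
  apply Quaternion.ext <;> simp

lemma norm_complexEmb_sq (φ : ℝ) (z : ℂ) : ‖complexEmb φ z‖ ^ 2 = ‖z‖ ^ 2 := by
  rw [Complex.sq_norm, Complex.normSq_apply, pow_two, ← Quaternion.normSq_eq_norm_mul_self,
    Quaternion.normSq_def', complexEmb_apply]
  simp only
  linear_combination z.im ^ 2 * Real.sin_sq_add_cos_sq φ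

lemma toQ_mk3 (a ρ φ : ℝ) :
    toQ (mk3 a (ρ * Real.cos φ) (ρ * Real.sin φ)) = complexEmb φ ⟨a, ρ⟩ := by
  simp [complexEmb_apply, toQ, mk3]
  rfl

lemma toQbar_mk3 (a ρ φ : ℝ) :
    toQbar (mk3 a (ρ * Real.cos φ) (ρ * Real.sin φ)) =
      complexEmb φ ⟨a, -ρ⟩ := by
  simp [complexEmb_apply, toQbar, mk3]
  rfl

lemma norm_zeta_mk3_sq (a ρ φ : ℝ) :
    ‖zeta (mk3 a (ρ * Real.cos φ) (ρ * Real.sin φ))‖ ^ 2 = ρ ^ 2 := by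
  rw [pow_two, ← Quaternion.normSq_eq_norm_mul_self, Quaternion.normSq_def']
  simp [zeta, mk3]
  linear_combination ρ ^ 2 * Real.sin_sq_add_cos_sq φ

lemma factorial_div_eq_binomCoeff (l k : ℕ) :
    ((2 * l + 2 * k).factorial : ℝ) / (k.factorial * (l + k).factorial) =
      (2 * l).factorial / l.factorial * 4 ^ k * binomCoeff (l + 1 / 2) k := by
  induction k with
  | zero => simp
  | succ k ih =>
    have h := succ_mul_binomCoeff_succ (l + 1 / 2) k
    have hk : (k + 1 : ℝ) ≠ 0 := by positivity
    apply mul_left_cancel₀ hk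
    rw [show (k + 1 : ℝ) * ((2 * l).factorial / l.factorial * 4 ^ (k + 1) *
      binomCoeff (l + 1 / 2) (k + 1)) = (4 * (l + 1 / 2 + k)) *
      ((2 * l).factorial / l.factorial * 4 ^ k * binomCoeff (l + 1 / 2) k) by
      rw [pow_succ]
      linear_combination (((2 * l).factorial : ℝ) / l.factorial * 4 ^ k * 4) * h, ← ih,
      show 2 * l + 2 * (k + 1) = 2 * l + 2 * k + 1 + 1 by ring,
      show l + (k + 1) = l + k + 1 by ring]
    simp only [Nat.factorial_succ]
    push_cast
    field_simp
    ring

lemma factorial_div_eq_binomCoeff_add_one (l k : ℕ) :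
    ((2 * l + 2 * k + 1).factorial : ℝ) / (k.factorial * (l + k).factorial) =
      (2 * l + 1).factorial / l.factorial * 4 ^ k * binomCoeff (l + 1 / 2 + 1) k := by
  have h1 := mul_binomCoeff_add_one (l + 1 / 2) k
  have h2 := factorial_div_eq_binomCoeff l k
  simp only [Nat.factorial_succ]
  push_cast
  linear_combination (2 * l + 2 * k + 1 : ℝ) * h2
    - 2 * ((2 * l).factorial : ℝ) / l.factorial * 4 ^ k * h1

lemma sum_range_eq_mixedSum (m l : ℕ) (w z : ℂ) :
    ∑ h ∈ range (m + 1),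
        (((2 * (l + (m - h)) + 1).factorial * (2 * l + 2 * h).factorial : ℝ) /
          (h.factorial * (m - h).factorial * (l + (m - h)).factorial * (l + h).factorial)) •
          (w ^ h * z ^ (m - h)) =
      ((2 * l).factorial * (2 * l + 1).factorial / (l.factorial : ℝ) ^ 2 * 4 ^ m) •
        mixedSum (l + 1 / 2) (l + 1 / 2 + 1) m w z := by
  rw [mixedSum, Finset.Nat.sum_antidiagonal_eq_sum_range_succ_mk, smul_sum]
  refine sum_congr rfl fun h hh => ?_
  have hm : m = h + (m - h) := by have := mem_range.1 hh; omega
  generalize m - h = k at hm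
  subst hm
  have h1 := factorial_div_eq_binomCoeff l h
  have h2 := factorial_div_eq_binomCoeff_add_one l k
  have h3 : ((2 * (l + k) + 1).factorial * (2 * l + 2 * h).factorial : ℝ) /
      (h.factorial * k.factorial * (l + k).factorial * (l + h).factorial) =
      (2 * l).factorial * (2 * l + 1).factorial / (l.factorial : ℝ) ^ 2 * 4 ^ (h + k) *
        (binomCoeff (l + 1 / 2) h * binomCoeff (l + 1 / 2 + 1) k) := by
    calc _ = ((2 * l + 2 * h).factorial : ℝ) / (h.factorial * (l + h).factorial) *
          (((2 * l + 2 * k + 1).factorial : ℝ) / (k.factorial * (l + k).factorial)) := by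
          rw [mul_add 2 l k]; field_simp
      _ = _ := by rw [h1, h2, pow_add]; ring
  rw [h3, mul_smul, ← Complex.real_smul]

/-- The squared norm of `A_n^l` on the meridian half-plane. -/
def appellProfile (n l : ℕ) (p : ℝ × ℝ) : ℝ :=
  ((n.factorial : ℝ) * (2 * l + 1).factorial / ((n + l + 1).factorial * l.factorial)) ^ 2 *
    (‖mixedSum (l + 1 / 2) (l + 1 / 2 + 1) (n - l) ⟨p.1, -p.2⟩ ⟨p.1, p.2⟩‖ ^ 2 * (p.2 ^ 2) ^ l)

lemma norm_appell_mk3_sq (n l : ℕ) (hl : l ≤ n) (a ρ φ : ℝ) :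
    ‖appell n l (mk3 a (ρ * Real.cos φ) (ρ * Real.sin φ))‖ ^ 2 = appellProfile n l (a, ρ) := by
  obtain ⟨m, rfl⟩ := Nat.exists_eq_add_of_le hl
  have hsum : ∑ h ∈ range (m + 1),
      (((2 * (l + m) - 2 * h + 1).factorial * (2 * l + 2 * h).factorial : ℝ) /
        (h.factorial * (m - h).factorial * (l + m - h).factorial * (l + h).factorial)) •
        (complexEmb φ ⟨a, -ρ⟩ ^ h * complexEmb φ ⟨a, ρ⟩ ^ (m - h)) =
      ((2 * l).factorial * (2 * l + 1).factorial / (l.factorial : ℝ) ^ 2 * 4 ^ m) •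
        complexEmb φ (mixedSum (l + 1 / 2) (l + 1 / 2 + 1) m ⟨a, -ρ⟩ ⟨a, ρ⟩) := by
    rw [← map_smul, ← sum_range_eq_mixedSum, map_sum]
    refine sum_congr rfl fun h hh => ?_
    have hm := mem_range.1 hh
    rw [map_smul, map_mul, map_pow, map_pow, show l + m - h = l + (m - h) by omega,
      show 2 * (l + m) - 2 * h = 2 * (l + (m - h)) by omega]
  rw [appell, appellProfile, toQ_mk3, toQbar_mk3, add_tsub_cancel_left, hsum, smul_mul_assoc,
    smul_smul, norm_smul, norm_mul (complexEmb _ _), norm_pow, mul_pow, mul_pow, norm_complexEmb_sq,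
    ← pow_mul, mul_comm l 2, pow_mul ‖zeta _‖, norm_zeta_mk3_sq, Real.norm_eq_abs, sq_abs]
  congr 2
  rw [pow_mul, show (2 : ℝ) ^ 2 = 4 by norm_num]
  field_simp

lemma mixedSum_mul (a b : ℝ) (m : ℕ) (r w z : ℂ) :
    mixedSum a b m (r * w) (r * z) = r ^ m * mixedSum a b m w z := by
  rw [mixedSum, mixedSum, mul_sum]
  refine sum_congr rfl fun p hp => ?_
  rw [← mem_antidiagonal.1 hp, pow_add]
  ring

lemma appellProfile_polar (n l : ℕ) (hl : l ≤ n) (r θ : ℝ) :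
    appellProfile n l (r * Real.cos θ, r * Real.sin θ) =
      r ^ (2 * n) * (((n.factorial : ℝ) * (2 * l + 1).factorial /
        ((n + l + 1).factorial * l.factorial)) ^ 2 *
        (‖circSum (l + 1 / 2) (l + 1 / 2 + 1) (n - l) θ‖ ^ 2 * Real.sin θ ^ (2 * l))) := by
  have hz : (⟨r * Real.cos θ, r * Real.sin θ⟩ : ℂ) = r * Complex.exp (θ * Complex.I) := by
    apply Complex.ext <;> simp [Complex.exp_ofReal_mul_I_re, Complex.exp_ofReal_mul_I_im]
  have hw : (⟨r * Real.cos θ, -(r * Real.sin θ)⟩ : ℂ) = r * Complex.exp (-(θ * Complex.I)) := by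
    apply Complex.ext <;> simp [exp_neg_mul_I_re, exp_neg_mul_I_im]
  obtain ⟨m, rfl⟩ := Nat.exists_eq_add_of_le hl
  rw [appellProfile, hz, hw, mixedSum_mul, ← circSum, add_tsub_cancel_left, norm_mul, norm_pow,
    Complex.norm_real, mul_pow, ← pow_mul, mul_comm m 2, pow_mul ‖r‖, Real.norm_eq_abs, sq_abs,
    mul_add, pow_add, pow_mul, pow_mul, pow_mul]
  ring

lemma continuous_appellProfile (n l : ℕ) : Continuous (appellProfile n l) := by
  have hz : Continuous fun p : ℝ × ℝ => (⟨p.1, p.2⟩ : ℂ) :=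
    Complex.equivRealProdCLM.symm.continuous
  have hw : Continuous fun p : ℝ × ℝ => (⟨p.1, -p.2⟩ : ℂ) :=
    hz.comp (continuous_fst.prodMk continuous_snd.neg)
  unfold appellProfile mixedSum
  fun_prop

/-- The volume-preserving identification of `ℝ × (ℝ × ℝ)` with `ℝ³`. -/
def mk3Equiv : ℝ × (ℝ × ℝ) ≃ᵐ R3 :=
  ((MeasurableEquiv.refl ℝ).prodCongr MeasurableEquiv.finTwoArrow.symm).trans
    ((MeasurableEquiv.piFinSuccAbove (fun _ : Fin 3 => ℝ) 0).symm.trans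
      (MeasurableEquiv.toLp 2 (Fin 3 → ℝ)))

lemma mk3Equiv_apply (p : ℝ × (ℝ × ℝ)) : mk3Equiv p = mk3 p.1 p.2.1 p.2.2 := by
  ext i
  fin_cases i <;> rfl

lemma measurePreserving_mk3Equiv : MeasurePreserving mk3Equiv :=
  (((MeasurePreserving.id volume).prod (volume_preserving_finTwoArrow ℝ).symm).trans
    ((volume_preserving_piFinSuccAbove (fun _ : Fin 3 => ℝ) 0).symm.trans
      (PiLp.volume_preserving_toLp (Fin 3))))

lemma mk3_mem_ball_iff (a b c : ℝ) :
    mk3 a b c ∈ ball (0 : R3) 1 ↔ a ^ 2 + (b ^ 2 + c ^ 2) < 1 := by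
  rw [mem_ball_zero_iff, EuclideanSpace.norm_eq, Real.sqrt_lt' one_pos]
  simp [Fin.sum_univ_three, mk3, add_assoc]

lemma integral_ball_eq (f : R3 → ℝ) (hf : Continuous f) :
    ∫ x in ball (0 : R3) 1, f x =
      ∫ a : ℝ, ∫ q : ℝ × ℝ, (ball (0 : R3) 1).indicator f (mk3 a q.1 q.2) := by
  have hint : Integrable ((ball (0 : R3) 1).indicator f) :=
    (integrable_indicator_iff measurableSet_ball).2
      ((hf.continuousOn.integrableOn_compact (isCompact_closedBall 0 1)).mono_set
        ball_subset_closedBall)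
  rw [← integral_indicator measurableSet_ball,
    ← measurePreserving_mk3Equiv.integral_comp mk3Equiv.measurableEmbedding]
  have h2 := (measurePreserving_mk3Equiv.integrable_comp_emb
    mk3Equiv.measurableEmbedding).2 hint
  simp only [Function.comp_def, mk3Equiv_apply] at h2 ⊢
  exact integral_prod _ h2

lemma integral_axisymmetric_slice (f : R3 → ℝ) (H : ℝ × ℝ → ℝ)
    (hfH : ∀ a ρ φ, f (mk3 a (ρ * Real.cos φ) (ρ * Real.sin φ)) = H (a, ρ)) (a : ℝ) :
    ∫ q : ℝ × ℝ, (ball (0 : R3) 1).indicator f (mk3 a q.1 q.2) =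
      2 * Real.pi * ∫ ρ : ℝ, {p : ℝ × ℝ | 0 < p.2 ∧ p.1 ^ 2 + p.2 ^ 2 < 1}.indicator
        (fun p => p.2 * H p) (a, ρ) := by
  rw [← integral_comp_polarCoord_symm]
  have hpt : ∀ p ∈ polarCoord.target,
      p.1 • (ball (0 : R3) 1).indicator f (mk3 a (polarCoord.symm p).1 (polarCoord.symm p).2) =
      {p : ℝ × ℝ | 0 < p.2 ∧ p.1 ^ 2 + p.2 ^ 2 < 1}.indicator (fun p => p.2 * H p) (a, p.1)
        * (1 : ℝ) := by
    classical
    rintro ⟨ρ, φ⟩ ⟨hρ, -⟩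
    simp only [polarCoord_symm_apply, smul_eq_mul, mul_one, Set.indicator_apply, hfH,
      mk3_mem_ball_iff]
    have h1 : (ρ * Real.cos φ) ^ 2 + (ρ * Real.sin φ) ^ 2 = ρ ^ 2 := by
      linear_combination ρ ^ 2 * Real.sin_sq_add_cos_sq φ
    have h2 : 0 < ρ := hρ
    simp [h1, h2]
  rw [setIntegral_congr_fun polarCoord.open_target.measurableSet hpt, polarCoord_target,
    Measure.volume_eq_prod, setIntegral_prod_mul
      (fun ρ => {p : ℝ × ℝ | 0 < p.2 ∧ p.1 ^ 2 + p.2 ^ 2 < 1}.indicator (fun p => p.2 * H p) (a, ρ))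
      (fun _ => (1 : ℝ))]
  have hvol : ∫ _ in Set.Ioo (-Real.pi) Real.pi, (1 : ℝ) = 2 * Real.pi := by
    rw [setIntegral_const, Real.volume_real_Ioo_of_le (by linarith [Real.pi_pos])]
    simp; ring
  rw [hvol, mul_comm, setIntegral_eq_integral_of_forall_compl_eq_zero]
  intro ρ hρ
  exact Set.indicator_of_notMem (fun h => hρ h.1) _

lemma integral_half_disc (H : ℝ × ℝ → ℝ) (K : ℝ → ℝ) (d : ℕ)
    (hHK : ∀ r θ, H (r * Real.cos θ, r * Real.sin θ) = r ^ d * K θ) :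
    ∫ p : ℝ × ℝ, {p : ℝ × ℝ | 0 < p.2 ∧ p.1 ^ 2 + p.2 ^ 2 < 1}.indicator
        (fun p => p.2 * H p) p =
      1 / (d + 3) * ∫ θ in (0 : ℝ)..Real.pi, K θ * Real.sin θ := by
  rw [← integral_comp_polarCoord_symm]
  have hpt : ∀ p ∈ polarCoord.target,
      p.1 • {p : ℝ × ℝ | 0 < p.2 ∧ p.1 ^ 2 + p.2 ^ 2 < 1}.indicator (fun p => p.2 * H p)
        (polarCoord.symm p) =
      (Set.Ioo (0 : ℝ) 1).indicator (fun r => r ^ (d + 2)) p.1 *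
        (Set.Ioo 0 Real.pi).indicator (fun θ => K θ * Real.sin θ) p.2 := by
    rintro ⟨r, θ⟩ ⟨hr, hθ1, hθ2⟩
    replace hr : 0 < r := hr
    simp only at hθ1 hθ2
    have h1 : (r * Real.cos θ) ^ 2 + (r * Real.sin θ) ^ 2 = r ^ 2 := by
      linear_combination r ^ 2 * Real.sin_sq_add_cos_sq θ
    have h2 : 0 < r * Real.sin θ ↔ 0 < θ := by
      rw [mul_pos_iff_of_pos_left hr]
      refine ⟨fun h => ?_, fun h => Real.sin_pos_of_pos_of_lt_pi h hθ2⟩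
      by_contra hneg
      exact absurd (Real.sin_nonpos_of_nonpos_of_neg_pi_le (not_lt.1 hneg) hθ1.le) (not_le.2 h)
    have h3 : r ^ 2 < 1 ↔ r < 1 := by
      rw [sq_lt_one_iff₀ hr.le]
    simp only [polarCoord_symm_apply, smul_eq_mul, Set.indicator_apply, Set.mem_ofPred_eq, h1, h2,
      h3, Set.mem_Ioo, hr, hθ2, true_and, and_true, hHK]
    by_cases ha : 0 < θ <;> by_cases hb : r < 1 <;> simp [ha, hb]
    ring
  rw [setIntegral_congr_fun polarCoord.open_target.measurableSet hpt, polarCoord_target,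
    Measure.volume_eq_prod, setIntegral_prod_mul]
  congr 1
  · rw [setIntegral_indicator measurableSet_Ioo, Set.inter_eq_self_of_subset_right
      (fun x hx => hx.1), ← integral_Ioc_eq_integral_Ioo, ← intervalIntegral.integral_of_le
      zero_le_one, integral_pow]
    push_cast
    norm_num [add_assoc]
  · rw [setIntegral_indicator measurableSet_Ioo, Set.inter_eq_self_of_subset_right
      (Set.Ioo_subset_Ioo_left (by linarith [Real.pi_pos])), ← integral_Ioc_eq_integral_Ioo,
      ← intervalIntegral.integral_of_le Real.pi_pos.le]

lemma integrable_half_disc (H : ℝ × ℝ → ℝ) (hH : Continuous H) :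
    Integrable ({p : ℝ × ℝ | 0 < p.2 ∧ p.1 ^ 2 + p.2 ^ 2 < 1}.indicator
      (fun p => p.2 * H p)) := by
  have hsq : Continuous fun p : ℝ × ℝ => p.1 ^ 2 + p.2 ^ 2 := by fun_prop
  have hopen : IsOpen {p : ℝ × ℝ | 0 < p.2 ∧ p.1 ^ 2 + p.2 ^ 2 < 1} :=
    (isOpen_lt continuous_const continuous_snd).inter (isOpen_lt hsq continuous_const)
  rw [integrable_indicator_iff hopen.measurableSet]
  have hc : Continuous fun p : ℝ × ℝ => p.2 * H p := by fun_prop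
  refine (hc.continuousOn.integrableOn_compact
    ((isCompact_Icc (a := (-1 : ℝ)) (b := 1)).prod
      (isCompact_Icc (a := (-1 : ℝ)) (b := 1)))).mono_set ?_
  rintro ⟨a, ρ⟩ ⟨-, h⟩
  simp only at h
  exact ⟨abs_le.1 ((sq_le_one_iff_abs_le_one a).1 (by nlinarith [sq_nonneg ρ])),
    abs_le.1 ((sq_le_one_iff_abs_le_one ρ).1 (by nlinarith [sq_nonneg a]))⟩

/-- Integral over the unit ball of `ℝ³` of a homogeneous function of degree `d` that is
invariant under rotations about the first axis. -/
lemma integral_ball_axisymmetric (f : R3 → ℝ) (H : ℝ × ℝ → ℝ) (K : ℝ → ℝ) (d : ℕ)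
    (hf : Continuous f) (hH : Continuous H)
    (hfH : ∀ a ρ φ, f (mk3 a (ρ * Real.cos φ) (ρ * Real.sin φ)) = H (a, ρ))
    (hHK : ∀ r θ, H (r * Real.cos θ, r * Real.sin θ) = r ^ d * K θ) :
    ∫ x in ball (0 : R3) 1, f x =
      2 * Real.pi / (d + 3) * ∫ θ in (0 : ℝ)..Real.pi, K θ * Real.sin θ := by
  rw [integral_ball_eq f hf]
  simp only [integral_axisymmetric_slice f H hfH]
  rw [integral_const_mul, ← integral_prod _ (integrable_half_disc H hH),
    ← Measure.volume_eq_prod, integral_half_disc H K d hHK]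
  ring

lemma continuous_toQ : Continuous toQ :=
  Quaternion.linearIsometryEquivTuple.symm.continuous.comp
    (f := fun x : R3 => !₂[x 0, x 1, x 2, 0]) (by fun_prop)

lemma continuous_toQbar : Continuous toQbar :=
  Quaternion.linearIsometryEquivTuple.symm.continuous.comp
    (f := fun x : R3 => !₂[x 0, -(x 1), -(x 2), 0]) (by fun_prop)

lemma continuous_zeta : Continuous zeta :=
  Quaternion.linearIsometryEquivTuple.symm.continuous.comp
    (f := fun x : R3 => !₂[x 1, 0, 0, -(x 2)]) (by fun_prop)

lemma continuous_appell (n l : ℕ) : Continuous (appell n l) := by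
  have h1 := continuous_toQ
  have h2 := continuous_toQbar
  have h3 := continuous_zeta
  unfold appell
  fun_prop

/-- the squared L²-norm of A_n^l over the unit ball. -/
theorem appell_norm_ball (n l : ℕ) (hl : l ≤ n) :
    ∫ x in ball (0 : R3) 1, ‖appell n l x‖ ^ 2 =
      4 ^ (l + 1) * (n.factorial : ℝ) ^ 2 * Real.pi /
        ((2 * (n : ℝ) + 3) * (n - l).factorial * (n + l + 1).factorial) := by
  rw [integral_ball_axisymmetric (fun x => ‖appell n l x‖ ^ 2) _ _ (2 * n)
    ((continuous_appell n l).norm.pow 2)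
    (continuous_appellProfile n l) (norm_appell_mk3_sq n l hl) (appellProfile_polar n l hl)]
  simp only [mul_assoc, ← pow_succ]
  rw [intervalIntegral.integral_const_mul, integral_norm_circSum_sq,
    show n - l + 2 * l + 1 = n + l + 1 by omega]
  push_cast
  field_simp
  ring
end
end
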